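/- Let ⟨f0, f1⟩ be an MWG-drawing of a pair ⟨G0, G1⟩ of finite simple graphs such that each G_i has diameter exactly 2: any two distinct vertices of G_i are adjacent or have a common neighbor, and G_i contains at least one pair of distinct non-adjacent vertices. Then the images of f0 and f1 are linearly separable: there exist a nonzero linear functional φ : ℝ² → ℝ and c ∈ ℝ such that φ(f0(u)) < c for every vertex u of G0 and φ(f1(v)) > c for every vertex v of G1. -/

import Mathlib

noncomputable section

/-- The Euclidean plane. -/
abbrev Pt : Type := EuclideanSpace ℝ (Fin 2)

/-- The Gabriel disk `D[u,v]`: the closed disk having `u` and `v` as antipodal points. -/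
def gabrielDisk (u v : Pt) : Set Pt := Metric.closedBall (midpoint ℝ u v) (dist u v / 2)

/-- `f` is a witness Gabriel drawing of the finite simple graph `G` with witness set `P`. -/
def IsWGDrawing {V : Type*} [Fintype V] (G : SimpleGraph V) (f : V → Pt) (P : Set Pt) : Prop :=
  Function.Injective f ∧ Disjoint (Set.range f) P ∧
    ∀ u v : V, u ≠ v → (G.Adj u v ↔ gabrielDisk (f u) (f v) ∩ P = ∅)

/-- `⟨f₀, f₁⟩` is a mutual witness Gabriel drawing of the pair `⟨G₀, G₁⟩`. -/
def IsMWGDrawing {V₀ V₁ : Type*} [Fintype V₀] [Fintype V₁]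
    (G₀ : SimpleGraph V₀) (G₁ : SimpleGraph V₁) (f₀ : V₀ → Pt) (f₁ : V₁ → Pt) : Prop :=
  Function.Injective f₀ ∧ Function.Injective f₁ ∧
    Disjoint (Set.range f₀) (Set.range f₁) ∧
    (∀ u v : V₀, u ≠ v → (G₀.Adj u v ↔ gabrielDisk (f₀ u) (f₀ v) ∩ Set.range f₁ = ∅)) ∧
    (∀ u v : V₁, u ≠ v → (G₁.Adj u v ↔ gabrielDisk (f₁ u) (f₁ v) ∩ Set.range f₀ = ∅))

/-- Two subsets of the plane are linearly separable. -/
def LinSep (A B : Set Pt) : Prop :=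
  ∃ (φ : Pt →ₗ[ℝ] ℝ) (c : ℝ), φ ≠ 0 ∧ (∀ a ∈ A, φ a < c) ∧ ∀ b ∈ B, c < φ b

/-- A segment leaving the convex hull of a finite planar set crosses a segment spanned by two of
its points. -/
theorem exists_segment_inter_of_notMem_convexHull {S : Set Pt} (hS : S.Finite) {x y : Pt}
    (hx : x ∈ convexHull ℝ S) (hy : y ∉ convexHull ℝ S) :
    ∃ u ∈ S, ∃ v ∈ S, ∃ z ∈ segment ℝ x y, z ∈ segment ℝ u v := by
  obtain ⟨z, hzs, hzS, hzi⟩ : ∃ z ∈ segment ℝ x y, z ∈ convexHull ℝ S ∧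
      z ∉ interior (convexHull ℝ S) := by
    by_contra! hcon
    obtain ⟨z, -, hz, hz'⟩ := (convex_segment (𝕜 := ℝ) x y).isPreconnected
      (interior (convexHull ℝ S)) (convexHull ℝ S)ᶜ isOpen_interior
      (hS.isClosed_convexHull ℝ).isOpen_compl
      (fun z hz => (em (z ∈ convexHull ℝ S)).imp (hcon z hz) id)
      ⟨x, left_mem_segment ℝ x y, hcon x (left_mem_segment ℝ x y) hx⟩
      ⟨y, right_mem_segment ℝ x y, hy⟩
    exact hz' (interior_subset hz)
  obtain ⟨ι, _, p, w, hpS, hp, hw, hw1, hz⟩ := eq_pos_convex_span_of_mem_convexHull hzS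
  have hpS' : ∀ i, p i ∈ S := fun i => hpS ⟨i, rfl⟩
  have hcard : Fintype.card ι ≤ 3 := by
    have h := hp.card_le_finrank_succ
    have h' := Submodule.finrank_le (vectorSpan ℝ (Set.range p))
    rw [finrank_euclideanSpace_fin] at h'
    omega
  have hcard3 : Fintype.card ι ≠ 3 := by
    intro h3
    have htop : affineSpan ℝ (Set.range p) = ⊤ := by
      rw [hp.affineSpan_eq_top_iff_card_eq_finrank_add_one, h3, finrank_euclideanSpace_fin]
    let b : AffineBasis ι ℝ Pt := ⟨p, hp, htop⟩
    apply hzi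
    apply interior_mono (convexHull_mono hpS)
    change z ∈ interior (convexHull ℝ (Set.range b))
    rw [b.interior_convexHull]
    intro i
    have hzc : Finset.univ.affineCombination ℝ b w = z := by
      rw [Finset.affineCombination_eq_linear_combination _ _ _ hw1]
      exact hz
    rw [← hzc, b.coord_apply_combination_of_mem (Finset.mem_univ i) hw1]
    exact hw i
  have hcard0 : Fintype.card ι ≠ 0 := by
    intro h0
    have := Fintype.card_eq_zero_iff.1 h0
    simp at hw1
  obtain h1 | h2 : Fintype.card ι = 1 ∨ Fintype.card ι = 2 := by omega
  · obtain ⟨i, hi⟩ := Fintype.card_eq_one_iff.1 h1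
    have : Unique ι := ⟨⟨i⟩, hi⟩
    rw [Fintype.sum_unique] at hw1 hz
    refine ⟨_, hpS' default, _, hpS' default, z, hzs, ?_⟩
    rw [← hz, hw1, one_smul]
    exact left_mem_segment ℝ _ _
  · let e := Fintype.equivFinOfCardEq h2
    rw [← e.symm.sum_comp, Fin.sum_univ_two] at hw1 hz
    exact ⟨_, hpS' (e.symm 0), _, hpS' (e.symm 1), z, hzs, _, _, (hw _).le, (hw _).le, hw1, hz⟩

/-- The power of `x` with respect to the Gabriel disk `D[u,v]`, in coordinates. -/
theorem inner_sub_sub_eq (u v x : Pt) :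
    inner ℝ (u - x) (v - x) = (u 0 - x 0) * (v 0 - x 0) + (u 1 - x 1) * (v 1 - x 1) := by
  simp only [PiLp.inner_apply, Fin.sum_univ_two, PiLp.sub_apply, RCLike.inner_apply, conj_trivial]
  ring

theorem mem_gabrielDisk_iff (u v x : Pt) :
    x ∈ gabrielDisk u v ↔ inner ℝ (u - x) (v - x) ≤ 0 := by
  have h1 : x - midpoint ℝ u v = -(1 / 2 : ℝ) • ((u - x) + (v - x)) := by
    rw [midpoint_eq_smul_add]; simp only [invOf_eq_inv]; module
  have h2 : dist u v = ‖(u - x) - (v - x)‖ := by rw [dist_eq_norm]; congr 1; abel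
  rw [gabrielDisk, Metric.mem_closedBall, dist_eq_norm, h1, h2, norm_smul]
  generalize u - x = p, v - x = q
  rw [← sq_le_sq₀ (by positivity) (by positivity), mul_pow, div_pow, norm_add_sq_real,
    norm_sub_sq_real]
  norm_num
  constructor <;> intro h <;> linarith

/-- The Gabriel disk of `u` and `v` avoids `P`. -/
def IsClear (P : Set Pt) (u v : Pt) : Prop := ∀ x ∈ P, 0 < (inner ℝ (u - x) (v - x) : ℝ)

theorem IsClear.symm {P : Set Pt} {u v : Pt} (h : IsClear P u v) : IsClear P v u :=
  fun x hx => by rw [real_inner_comm]; exact h x hx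

theorem isClear_iff {P : Set Pt} {u v : Pt} : IsClear P u v ↔ gabrielDisk u v ∩ P = ∅ := by
  simp only [IsClear, Set.eq_empty_iff_forall_notMem, Set.mem_inter_iff, mem_gabrielDisk_iff,
    not_and', not_le]

/-- Any two points of `R` have a common point of `R` with which they are clear of `B`. -/
def HasCommon (R B : Set Pt) : Prop :=
  ∀ u ∈ R, ∀ v ∈ R, ∃ w ∈ R, IsClear B u w ∧ IsClear B v w

theorem notMem_convexHull_of_inner_pos {u v w x : Pt} (hu : 0 < (inner ℝ (u - x) (w - x) : ℝ))
    (hv : 0 < (inner ℝ (v - x) (w - x) : ℝ)) : x ∉ convexHull ℝ {u, w, v} := by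
  intro hx
  have hconv : Convex ℝ {p : Pt | 0 < (inner ℝ (p - x) (w - x) : ℝ)} := by
    have := convex_halfSpace_gt (𝕜 := ℝ)
      (f := fun p : Pt => (inner ℝ p (w - x) : ℝ))
      ⟨fun a b => inner_add_left _ _ _, fun c a => real_inner_smul_left _ _ _⟩
      (inner ℝ x (w - x))
    simpa only [inner_sub_left, sub_pos] using this
  have hw : 0 < (inner ℝ (w - x) (w - x) : ℝ) := by
    apply lt_of_le_of_ne real_inner_self_nonneg
    intro h
    rw [inner_self_eq_zero.1 h.symm, inner_zero_right] at hu
    exact lt_irrefl _ hu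
  have h := convexHull_min (s := {u, w, v}) (by
    rintro p (rfl | rfl | rfl)
    exacts [hu, hw, hv]) hconv hx
  simp at h

/-- Clear pairs of opposite colours do not cross: their radical axis separates them. -/
theorem disjoint_segment_of_isClear {u v a b : Pt} (h : IsClear {a, b} u v)
    (h' : IsClear {u, v} a b) {z : Pt} (hz : z ∈ segment ℝ u v) (hz' : z ∈ segment ℝ a b) :
    False := by
  obtain ⟨s, s', hs, hs', hs1, hsz⟩ := hz
  obtain ⟨t, t', ht, ht', ht1, htz⟩ := hz'
  have ha := h a (by simp)
  have hb := h b (by simp)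
  have hu := h' u (by simp)
  have hv := h' v (by simp)
  have e0 := congrArg (fun p : Pt => p 0) (hsz.trans htz.symm)
  have e1 := congrArg (fun p : Pt => p 1) (hsz.trans htz.symm)
  simp only [inner_sub_sub_eq] at ha hb hu hv
  simp only [PiLp.add_apply, PiLp.smul_apply, smul_eq_mul] at e0 e1
  obtain rfl : s' = 1 - s := by linarith
  obtain rfl : t' = 1 - t := by linarith
  have key : ∀ k m n l : ℝ, 0 ≤ k → 0 ≤ 1 - k → 0 < m → 0 < n → l = k * m + (1 - k) * n →
      0 < l := by
    rintro k m n l hk hk' hm hn rfl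
    rcases hk.eq_or_lt with rfl | hk
    · linarith
    · have := mul_pos hk hm
      have := mul_nonneg hk' hn.le
      linarith
  have p1 := key s _ _ _ hs hs' hu hv rfl
  have p2 := key t _ _ _ ht ht' ha hb rfl
  have : (s * ((a 0 - u 0) * (b 0 - u 0) + (a 1 - u 1) * (b 1 - u 1)) +
      (1 - s) * ((a 0 - v 0) * (b 0 - v 0) + (a 1 - v 1) * (b 1 - v 1))) +
      (t * ((u 0 - a 0) * (v 0 - a 0) + (u 1 - a 1) * (v 1 - a 1)) +
      (1 - t) * ((u 0 - b 0) * (v 0 - b 0) + (u 1 - b 1) * (v 1 - b 1))) = 0 := by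
    linear_combination (u 0 + v 0 - a 0 - b 0) * e0 + (u 1 + v 1 - a 1 - b 1) * e1
  linarith

/-- A segment with endpoints outside the triangle `u w v` that crosses `u v` crosses another side. -/
theorem exists_mem_segment_of_triangle {u v w a b z : Pt} (hz : z ∈ segment ℝ u v)
    (hz' : z ∈ segment ℝ a b) (ha : a ∉ convexHull ℝ {u, w, v})
    (hb : b ∉ convexHull ℝ {u, w, v}) :
    ∃ y, (y = u ∨ y = v) ∧ ∃ z ∈ segment ℝ y w, z ∈ segment ℝ a b := by
  set T := convexHull ℝ {u, w, v} with hT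
  have hTc : Convex ℝ T := convex_convexHull ℝ _
  have huT : u ∈ T := subset_convexHull ℝ _ (by simp)
  have hvT : v ∈ T := subset_convexHull ℝ _ (by simp)
  have hwT : w ∈ T := subset_convexHull ℝ _ (by simp)
  have hzT : z ∈ T := hTc.segment_subset huT hvT hz
  let ℓ : Pt → ℝ := fun p => (b 0 - a 0) * (p 1 - a 1) - (b 1 - a 1) * (p 0 - a 0)
  have hℓ : ∀ (p q : Pt) (s t : ℝ), s + t = 1 → ℓ (s • p + t • q) = s * ℓ p + t * ℓ q := by
    intro p q s t hst
    obtain rfl : t = 1 - s := by linarith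
    simp only [ℓ, PiLp.add_apply, PiLp.smul_apply, smul_eq_mul]
    ring
  obtain ⟨k, hk0, hk1, rfl⟩ : ∃ k : ℝ, 0 ≤ k ∧ k ≤ 1 ∧ z = (1 - k) • a + k • b := by
    obtain ⟨t, k, ht, hk, h1, rfl⟩ := hz'
    exact ⟨k, hk, by linarith, by rw [← h1]; simp⟩
  have hab : b ≠ a := by
    rintro rfl
    apply ha
    rwa [← add_smul, sub_add_cancel, one_smul] at hzT
  have hline : ∀ p, ℓ p = 0 → ∃ m : ℝ, p = (1 - m) • a + m • b := by
    intro p hp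
    have hD : 0 < (b 0 - a 0) ^ 2 + (b 1 - a 1) ^ 2 := by
      by_contra hcon
      apply hab
      ext i
      fin_cases i
      · change b 0 = a 0
        nlinarith [sq_nonneg (b 0 - a 0), sq_nonneg (b 1 - a 1)]
      · change b 1 = a 1
        nlinarith [sq_nonneg (b 0 - a 0), sq_nonneg (b 1 - a 1)]
    refine ⟨((p 0 - a 0) * (b 0 - a 0) + (p 1 - a 1) * (b 1 - a 1)) /
      ((b 0 - a 0) ^ 2 + (b 1 - a 1) ^ 2), ?_⟩
    simp only [ℓ] at hp
    ext i
    fin_cases i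
    · simp only [Fin.zero_eta, PiLp.add_apply, PiLp.smul_apply, smul_eq_mul]
      field_simp
      linear_combination -(b 1 - a 1) * hp
    · simp only [Fin.mk_one, PiLp.add_apply, PiLp.smul_apply, smul_eq_mul]
      field_simp
      linear_combination (b 0 - a 0) * hp
  have hside : ∃ y, (y = u ∨ y = v) ∧ ∃ p ∈ segment ℝ y w, ℓ p = 0 := by
    have h0 : ℓ ((1 - k) • a + k • b) = 0 := by
      rw [hℓ _ _ _ _ (by ring)]; simp only [ℓ]; ring
    obtain ⟨s, s', hs, hs', hs1, hsz⟩ := hz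
    rw [← hsz, hℓ _ _ _ _ hs1] at h0
    have hcross : ∀ y, ℓ y * ℓ w ≤ 0 → ∃ p ∈ segment ℝ y w, ℓ p = 0 := by
      intro y hy
      by_cases he : ℓ y = ℓ w
      · refine ⟨w, right_mem_segment ℝ y w, ?_⟩
        rw [he] at hy
        nlinarith
      have hne : ℓ y - ℓ w ≠ 0 := sub_ne_zero.2 he
      have hsq : 0 < (ℓ y - ℓ w) ^ 2 := by positivity
      refine ⟨_, ⟨-ℓ w * (ℓ y - ℓ w) / (ℓ y - ℓ w) ^ 2, ℓ y * (ℓ y - ℓ w) / (ℓ y - ℓ w) ^ 2,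
        div_nonneg ?_ hsq.le, div_nonneg ?_ hsq.le, ?_, rfl⟩, ?_⟩
      · nlinarith [sq_nonneg (ℓ w)]
      · nlinarith [sq_nonneg (ℓ y)]
      · field_simp; ring
      · rw [hℓ]
        · field_simp; ring
        · field_simp; ring
    by_cases hu : ℓ u * ℓ w ≤ 0
    · exact ⟨u, Or.inl rfl, hcross u hu⟩
    · refine ⟨v, Or.inr rfl, hcross v ?_⟩
      by_contra hv
      push Not at hu hv
      have h1 : s * (ℓ u * ℓ w) + s' * (ℓ v * ℓ w) = 0 := by linear_combination ℓ w * h0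
      rcases hs.eq_or_lt with rfl | hs
      · obtain rfl : s' = 1 := by linarith
        linarith
      · nlinarith [mul_pos hs hu, mul_nonneg hs' hv.le]
  obtain ⟨y, hy, p, hp, hp0⟩ := hside
  refine ⟨y, hy, p, hp, ?_⟩
  have hpT : p ∈ T := by
    refine hTc.segment_subset ?_ hwT hp
    rcases hy with rfl | rfl <;> assumption
  obtain ⟨m, rfl⟩ := hline p hp0
  have hmid : ∀ n : ℝ, ((m ≤ n ∧ n ≤ k) ∨ (k ≤ n ∧ n ≤ m)) → (1 - n) • a + n • b ∈ T := by
    intro n hn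
    by_cases hkm : k = m
    · obtain rfl : n = k := by rcases hn with h | h <;> linarith
      exact hzT
    have hne : k - m ≠ 0 := sub_ne_zero.2 hkm
    have hsq : 0 < (k - m) ^ 2 := by positivity
    have h := hTc hpT hzT (a := (k - n) * (k - m) / (k - m) ^ 2)
      (b := (n - m) * (k - m) / (k - m) ^ 2)
      (div_nonneg (by rcases hn with h | h <;> nlinarith) hsq.le)
      (div_nonneg (by rcases hn with h | h <;> nlinarith) hsq.le) (by field_simp; ring)
    convert h using 1
    ext i
    simp only [PiLp.add_apply, PiLp.smul_apply, smul_eq_mul]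
    field_simp
    ring
  refine ⟨1 - m, m, ?_, ?_, by ring, rfl⟩
  · by_contra hm
    apply hb
    simpa using hmid 1 (Or.inr ⟨hk1, by linarith⟩)
  · by_contra hm
    apply ha
    simpa using hmid 0 (Or.inl ⟨by linarith, hk0⟩)

/-- Under the common-neighbour conditions, no red segment meets a blue segment. -/
theorem HasCommon.disjoint_segment {R B : Set Pt} (hR : HasCommon R B) (hB : HasCommon B R)
    {u v a b z : Pt} (hu : u ∈ R) (hv : v ∈ R) (ha : a ∈ B) (hb : b ∈ B)
    (hz : z ∈ segment ℝ u v) (hz' : z ∈ segment ℝ a b) : False := by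
  obtain ⟨w, hw, huw, hvw⟩ := hR u hu v hv
  obtain ⟨c, hc, hac, hbc⟩ := hB a ha b hb
  obtain ⟨y, hy, p, hp, hp'⟩ := exists_mem_segment_of_triangle hz hz'
    (notMem_convexHull_of_inner_pos (huw a ha) (hvw a ha))
    (notMem_convexHull_of_inner_pos (huw b hb) (hvw b hb))
  have hyR : y ∈ R := by rcases hy with rfl | rfl <;> assumption
  have hyw : IsClear B y w := by rcases hy with rfl | rfl <;> assumption
  obtain ⟨d, hd, q, hq, hq'⟩ := exists_mem_segment_of_triangle hp' hp
    (notMem_convexHull_of_inner_pos (hac y hyR) (hbc y hyR))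
    (notMem_convexHull_of_inner_pos (hac w hw) (hbc w hw))
  have hdB : d ∈ B := by rcases hd with rfl | rfl <;> assumption
  have hdc : IsClear R d c := by rcases hd with rfl | rfl <;> assumption
  refine disjoint_segment_of_isClear (u := y) (v := w) (a := d) (b := c) ?_ ?_ hq' hq
  · rintro x (rfl | rfl)
    exacts [hyw _ hdB, hyw _ hc]
  · rintro x (rfl | rfl)
    exacts [hdc _ hyR, hdc _ hw]

theorem HasCommon.mem_convexHull {R B : Set Pt} (hBf : B.Finite) (hR : HasCommon R B)
    (hB : HasCommon B R) {r r' : Pt} (hr : r ∈ R) (hr' : r' ∈ R) (h : r ∈ convexHull ℝ B) :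
    r' ∈ convexHull ℝ B := by
  by_contra h'
  obtain ⟨a, ha, b, hb, z, hz, hz'⟩ := exists_segment_inter_of_notMem_convexHull hBf h h'
  exact hR.disjoint_segment hB hr hr' ha hb hz hz'

/-- If the convex hulls meet, then one of them contains a point of the opposite colour. -/
theorem HasCommon.exists_mem_convexHull {R B : Set Pt} (hRf : R.Finite) (hBf : B.Finite)
    (hR : HasCommon R B) (hB : HasCommon B R)
    (h : ¬ Disjoint (convexHull ℝ R) (convexHull ℝ B)) :
    (∃ r ∈ R, r ∈ convexHull ℝ B) ∨ ∃ b ∈ B, b ∈ convexHull ℝ R := by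
  by_contra! hcon
  obtain ⟨hRB, hBR⟩ := hcon
  obtain ⟨x, hxR, hxB⟩ := Set.not_disjoint_iff.1 h
  obtain ⟨b, hb⟩ := convexHull_nonempty_iff.1 ⟨x, hxB⟩
  obtain ⟨u, hu, v, hv, z, hz, hzuv⟩ :=
    exists_segment_inter_of_notMem_convexHull hRf hxR (hBR b hb)
  have hzB : z ∈ convexHull ℝ B :=
    (convex_convexHull ℝ B).segment_subset hxB (subset_convexHull ℝ B hb) hz
  obtain ⟨a, ha, c, hc, p, hp, hp'⟩ :=
    exists_segment_inter_of_notMem_convexHull hBf hzB (hRB u hu)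
  exact hR.disjoint_segment hB hu hv ha hc
    ((convex_segment u v).segment_subset hzuv (left_mem_segment ℝ u v) hp) hp'

/-- Twice the signed area of the triangle `o p q`. -/
def cross (o p q : Pt) : ℝ := (p 0 - o 0) * (q 1 - o 1) - (p 1 - o 1) * (q 0 - o 0)

theorem false_of_inner_pos {μ κ x y p q : ℝ} (hκ : 0 < κ) (hμ : 0 ≤ μ) (hμκ : μ + κ ≤ 1)
    (g1 : 0 < μ * (x * p + y * q) - κ * (x ^ 2 + y ^ 2))
    (g2 : 0 < (μ * p - κ * x) * ((μ * p - κ * x) - p)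
      + (μ * q - κ * y) * ((μ * q - κ * y) - q)) : False := by
  obtain ⟨m, hm⟩ : ∃ m, m = x * p + y * q := ⟨_, rfl⟩
  obtain ⟨N, hN⟩ : ∃ N, N = x ^ 2 + y ^ 2 := ⟨_, rfl⟩
  obtain ⟨A, hA⟩ : ∃ A, A = p ^ 2 + q ^ 2 := ⟨_, rfl⟩
  have hCS : m ^ 2 ≤ N * A := by
    rw [hm, hN, hA]
    linarith [sq_nonneg (x * q - y * p)]
  rw [← hm, ← hN] at g1
  have g2' : 0 < -(μ * (1 - μ) * A) + κ ^ 2 * N - κ * (2 * μ - 1) * m := by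
    rw [hm, hN, hA]
    linarith
  have hN0 : 0 ≤ N := by rw [hN]; positivity
  have hμm : 0 < μ * m := by linarith [mul_nonneg hκ.le hN0]
  have hμ0 : 0 < μ := lt_of_le_of_ne hμ (by rintro rfl; simp at hμm)
  have hm0 : 0 < m := (mul_pos_iff_of_pos_left hμ0).1 hμm
  have hNpos : 0 < N := by
    refine lt_of_le_of_ne hN0 fun h => ?_
    rw [← h, zero_mul] at hCS
    linarith [pow_pos hm0 2]
  have k1 : 0 < (1 - μ) * (κ * m - μ * A) := by linarith [mul_pos hκ g1]
  have k2 : 0 < κ * m - μ * A := (mul_pos_iff_of_pos_left (by linarith)).1 k1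
  linarith [mul_pos hm0 g1, mul_pos k2 hNpos, mul_le_mul_of_nonneg_left hCS hμ]

/-- If `e` lies on the side of `a` of the line `b w`, beyond `w`, and the blue segment `b e` misses
the red segment `a w`, then `e` lies beyond the line `b a`. -/
theorem cross_mul_cross_pos {a b e w : Pt} (haw : cross b w a ≠ 0)
    (he : 0 ≤ cross b w e * cross b w a) (hew : 0 < -(inner ℝ (e - w) (b - w) : ℝ))
    (hclear : 0 < (inner ℝ (a - e) (w - e) : ℝ))
    (hdisj : ∀ z ∈ segment ℝ b e, z ∉ segment ℝ a w) : 0 < cross b a e * cross b w a := by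
  by_contra hneg
  have hsq : 0 < cross b w a ^ 2 := by positivity
  obtain ⟨μ, hμ⟩ : ∃ μ, μ = cross b w e / cross b w a := ⟨_, rfl⟩
  obtain ⟨ν, hν⟩ : ∃ ν, ν = -cross b a e / cross b w a := ⟨_, rfl⟩
  have hμ0 : 0 ≤ μ := by
    rw [hμ, ← mul_div_mul_right _ _ haw]
    exact div_nonneg he (by nlinarith)
  have hν0 : 0 ≤ ν := by
    rw [hν, ← mul_div_mul_right _ _ haw]
    exact div_nonneg (by linarith) (by nlinarith)
  have e0 : e 0 - b 0 = μ * (a 0 - b 0) + ν * (w 0 - b 0) := by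
    rw [hμ, hν]; field_simp; simp only [cross]; ring
  have e1 : e 1 - b 1 = μ * (a 1 - b 1) + ν * (w 1 - b 1) := by
    rw [hμ, hν]; field_simp; simp only [cross]; ring
  rcases le_or_gt 1 (μ + ν) with h1 | h1
  · have hpos : 0 < μ + ν := by linarith
    refine hdisj ((μ / (μ + ν)) • a + (ν / (μ + ν)) • w) ?_
      ⟨_, _, div_nonneg hμ0 hpos.le, div_nonneg hν0 hpos.le, by field_simp, rfl⟩
    refine ⟨1 - 1 / (μ + ν), 1 / (μ + ν), ?_, by positivity, by ring, ?_⟩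
    · rw [sub_nonneg, div_le_one hpos]
      exact h1
    · ext i
      fin_cases i
      · simp only [Fin.zero_eta, PiLp.add_apply, PiLp.smul_apply, smul_eq_mul]
        field_simp
        linear_combination e0
      · simp only [Fin.mk_one, PiLp.add_apply, PiLp.smul_apply, smul_eq_mul]
        field_simp
        linear_combination e1
  · rw [inner_sub_sub_eq] at hew hclear
    obtain ⟨p, hp⟩ : ∃ p, p = a 0 - w 0 := ⟨_, rfl⟩
    obtain ⟨q, hq⟩ : ∃ q, q = a 1 - w 1 := ⟨_, rfl⟩
    obtain ⟨x, hx⟩ : ∃ x, x = w 0 - b 0 := ⟨_, rfl⟩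
    obtain ⟨y, hy⟩ : ∃ y, y = w 1 - b 1 := ⟨_, rfl⟩
    obtain ⟨κ, hκ⟩ : ∃ κ, κ = 1 - (μ + ν) := ⟨_, rfl⟩
    have hκ0 : 0 < κ := by linarith
    have f0 : e 0 - w 0 = μ * p - κ * x := by rw [hp, hx, hκ]; linear_combination e0
    have f1 : e 1 - w 1 = μ * q - κ * y := by rw [hq, hy, hκ]; linear_combination e1
    have g1 : 0 < μ * (x * p + y * q) - κ * (x ^ 2 + y ^ 2) := by
      have h1 : b 0 - w 0 = -x := by rw [hx]; ring
      have h2 : b 1 - w 1 = -y := by rw [hy]; ring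
      rw [f0, f1, h1, h2] at hew
      linarith
    have g2 : 0 < (μ * p - κ * x) * ((μ * p - κ * x) - p)
        + (μ * q - κ * y) * ((μ * q - κ * y) - q) := by
      have h1' : a 0 - e 0 = p - (μ * p - κ * x) := by rw [← f0, hp]; ring
      have h2 : a 1 - e 1 = q - (μ * q - κ * y) := by rw [← f1, hq]; ring
      have h3 : w 0 - e 0 = -(μ * p - κ * x) := by rw [← f0]; ring
      have h4 : w 1 - e 1 = -(μ * q - κ * y) := by rw [← f1]; ring
      rw [h1', h2, h3, h4] at hclear
      linarith
    exact false_of_inner_pos hκ0 hμ0 (by linarith) g1 g2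

theorem false_of_mul_pos {x x' y y' s s' t t' N : ℝ} (hx : 0 < x) (hx' : 0 < x') (hs : 0 < s)
    (hs' : 0 < s') (hN : 0 ≤ N) (hA : x * x' + y * y' ≤ 0) (hE : 0 < s * s' + t * t')
    (h : 0 < (x * t - y * s - y * N) * y) (h' : 0 < (x' * t' - y' * s' - y' * N) * y') :
    False := by
  have hxx : 0 < x * x' := mul_pos hx hx'
  have hss : 0 < s * s' := mul_pos hs hs'
  have hyy : y * y' < 0 := by linarith
  have j1 : y ^ 2 * s < x * (t * y) := by linarith [mul_nonneg (sq_nonneg y) hN]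
  have j2 : y' ^ 2 * s' < x' * (t' * y') := by linarith [mul_nonneg (sq_nonneg y') hN]
  have j3 : (y ^ 2 * s) * (y' ^ 2 * s') < (x * (t * y)) * (x' * (t' * y')) :=
    mul_lt_mul'' j1 j2 (by positivity) (by positivity)
  have j4 : 0 < (y * y') * (s * s') - (x * x') * (t * t') := by
    by_contra h
    linarith [mul_nonneg_of_nonpos_of_nonpos hyy.le (not_lt.1 h)]
  linarith [mul_pos hxx hE, mul_nonneg (neg_nonneg.2 hA) hss.le]

/-- If `a` and `c` see each other at `b` under a non-acute angle, then no two blue points beyond `w`,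
on the sides of `a` and of `c` of the line `b w`, have an acute angle at `w`. -/
theorem false_of_acute {a c b w e e' : Pt} (hac : (inner ℝ (a - b) (c - b) : ℝ) ≤ 0)
    (haw : 0 < (inner ℝ (a - b) (w - b) : ℝ)) (hcw : 0 < (inner ℝ (c - b) (w - b) : ℝ))
    (he : 0 ≤ cross b w e * cross b w a) (he' : 0 ≤ cross b w e' * cross b w c)
    (hew : 0 < -(inner ℝ (e - w) (b - w) : ℝ)) (hew' : 0 < -(inner ℝ (e' - w) (b - w) : ℝ))
    (hee' : 0 < (inner ℝ (e - w) (e' - w) : ℝ))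
    (hae : 0 < (inner ℝ (a - e) (w - e) : ℝ)) (hce' : 0 < (inner ℝ (c - e') (w - e') : ℝ))
    (hd : ∀ z ∈ segment ℝ b e, z ∉ segment ℝ a w)
    (hd' : ∀ z ∈ segment ℝ b e', z ∉ segment ℝ c w) : False := by
  obtain ⟨N, hN⟩ : ∃ N, N = (w 0 - b 0) ^ 2 + (w 1 - b 1) ^ 2 := ⟨_, rfl⟩
  obtain ⟨x, hx⟩ : ∃ x : ℝ, x = inner ℝ (a - b) (w - b) := ⟨_, rfl⟩
  obtain ⟨x', hx'⟩ : ∃ x : ℝ, x = inner ℝ (c - b) (w - b) := ⟨_, rfl⟩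
  obtain ⟨y, hy⟩ : ∃ y : ℝ, y = cross b w a := ⟨_, rfl⟩
  obtain ⟨y', hy'⟩ : ∃ y : ℝ, y = cross b w c := ⟨_, rfl⟩
  obtain ⟨s, hs⟩ : ∃ s : ℝ, s = -inner ℝ (e - w) (b - w) := ⟨_, rfl⟩
  obtain ⟨s', hs'⟩ : ∃ s : ℝ, s = -inner ℝ (e' - w) (b - w) := ⟨_, rfl⟩
  obtain ⟨t, ht⟩ : ∃ t : ℝ, t = cross b w e := ⟨_, rfl⟩
  obtain ⟨t', ht'⟩ : ∃ t : ℝ, t = cross b w e' := ⟨_, rfl⟩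
  rw [← hx] at haw
  rw [← hx'] at hcw
  have hN0 : 0 ≤ N := by rw [hN]; positivity
  have hN1 : 0 < N := by
    refine lt_of_le_of_ne hN0 fun h => ?_
    have h0 : w 0 - b 0 = 0 := by nlinarith [sq_nonneg (w 0 - b 0), sq_nonneg (w 1 - b 1)]
    have h1 : w 1 - b 1 = 0 := by nlinarith [sq_nonneg (w 0 - b 0), sq_nonneg (w 1 - b 1)]
    rw [hx, inner_sub_sub_eq, h0, h1] at haw
    simp at haw
  have hA : x * x' + y * y' ≤ 0 := by
    have : x * x' + y * y' = N * inner ℝ (a - b) (c - b) := by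
      rw [hx, hx', hy, hy', hN]; simp only [inner_sub_sub_eq, cross]; ring
    rw [this]
    exact mul_nonpos_of_nonneg_of_nonpos hN0 hac
  have hE : 0 < s * s' + t * t' := by
    have : s * s' + t * t' = N * inner ℝ (e - w) (e' - w) := by
      rw [hs, hs', ht, ht', hN]; simp only [inner_sub_sub_eq, cross]; ring
    rw [this]
    exact mul_pos hN1 hee'
  have hxx : 0 < x * x' := mul_pos haw hcw
  have hyy : y * y' < 0 := by linarith
  have hy0 : y ≠ 0 := by rintro rfl; simp at hyy
  have hy0' : y' ≠ 0 := by rintro rfl; simp at hyy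
  have h1 := cross_mul_cross_pos (hy ▸ hy0) he hew hae hd
  have h2 := cross_mul_cross_pos (hy' ▸ hy0') he' hew' hce' hd'
  have i1 : N * cross b a e = x * t - y * s - y * N := by
    rw [hx, ht, hy, hs, hN]; simp only [inner_sub_sub_eq, cross]; ring
  have i2 : N * cross b c e' = x' * t' - y' * s' - y' * N := by
    rw [hx', ht', hy', hs', hN]; simp only [inner_sub_sub_eq, cross]; ring
  rw [← hy] at h1
  rw [← hy'] at h2
  refine false_of_mul_pos haw hcw (hs ▸ hew) (hs' ▸ hew') hN0 hA hE ?_ ?_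
  · rw [← i1, mul_assoc]
    exact mul_pos hN1 h1
  · rw [← i2, mul_assoc]
    exact mul_pos hN1 h2

/-- If the blue hull contains the red points, then the red points are pairwise clear. -/
theorem HasCommon.isClear_of_subset {R B : Set Pt} (hBf : B.Finite) (hR : HasCommon R B)
    (hB : HasCommon B R) (hsub : R ⊆ convexHull ℝ B) {a c : Pt} (ha : a ∈ R) (hc : c ∈ R) :
    IsClear B a c := by
  intro b hb
  by_contra! hac
  obtain ⟨w, hw, haw, hcw⟩ := hR a ha c hc
  have hdis : ∀ {u v}, u ∈ R → v ∈ R → ∀ {p q}, p ∈ B → q ∈ B → ∀ z ∈ segment ℝ p q,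
      z ∉ segment ℝ u v := fun hu hv _ _ hp hq z hz hz' => hR.disjoint_segment hB hu hv hp hq hz' hz
  have hbw : w - b ≠ 0 := by
    intro h
    have := haw b hb
    rw [h, inner_zero_right] at this
    exact lt_irrefl _ this
  obtain ⟨T, hT0, hT⟩ : ∃ T : ℝ, 0 < T ∧ w + T • (w - b) ∉ convexHull ℝ B := by
    by_contra! hcon
    obtain ⟨C, hC⟩ := (hBf.isCompact_convexHull ℝ).isBounded.exists_norm_le
    have hpos : 0 < ‖w - b‖ := norm_pos_iff.2 hbw
    have hw' := hC _ (hsub hw)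
    have hC0 : 0 ≤ C := (norm_nonneg _).trans hw'
    have h := hC _ (hcon ((2 * C + 1) / ‖w - b‖) (by positivity))
    have h2 : ‖((2 * C + 1) / ‖w - b‖) • (w - b)‖ = 2 * C + 1 := by
      rw [norm_smul, Real.norm_eq_abs, abs_of_nonneg (by positivity)]
      field_simp
    have h3 := norm_sub_le (w + ((2 * C + 1) / ‖w - b‖) • (w - b)) w
    rw [add_sub_cancel_left, h2] at h3
    linarith
  obtain ⟨e, he, e', he', z, ⟨α, β, hα, hβ, hαβ, hz⟩, k, k', hk, hk', hkk, hz'⟩ :=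
    exists_segment_inter_of_notMem_convexHull hBf (hsub hw) hT
  obtain ⟨τ, hτ⟩ : ∃ τ, τ = β * T := ⟨_, rfl⟩
  have hzw : z = w + τ • (w - b) := by
    rw [← hz, hτ, smul_add, ← add_assoc, ← add_smul, hαβ, one_smul, smul_smul]
  have hτ0 : 0 < τ := by
    refine lt_of_le_of_ne (hτ ▸ mul_nonneg hβ hT0.le) ?_
    rintro rfl
    rw [zero_smul, add_zero] at hzw
    exact hdis hw hw he he' z ⟨k, k', hk, hk', hkk, hz'⟩ (hzw ▸ left_mem_segment ℝ w w)
  have hcone : ∀ p : Pt, τ * -(inner ℝ (p - w) (b - w) : ℝ) =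
      k * inner ℝ (e - w) (p - w) + k' * inner ℝ (e' - w) (p - w) := by
    intro p
    have h0 : τ • (w - b) = k • (e - w) + k' • (e' - w) := by
      have h1 : τ • (w - b) = z - w := by rw [hzw]; abel
      rw [h1, ← hz', smul_sub, smul_sub]
      nth_rewrite 1 [← one_smul ℝ w]
      rw [← hkk, add_smul]
      abel
    rw [← real_inner_smul_left, ← real_inner_smul_left, ← inner_add_left, ← h0,
      real_inner_smul_left, ← neg_sub b w, inner_neg_left, real_inner_comm]
  have hcross : k * cross b w e + k' * cross b w e' = 0 := by
    have h : k • e + k' • e' = w + τ • (w - b) := hz'.trans hzw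
    have h0 := congrArg (fun p : Pt => p 0) h
    have h1 := congrArg (fun p : Pt => p 1) h
    simp only [PiLp.add_apply, PiLp.smul_apply, PiLp.sub_apply, smul_eq_mul] at h0 h1
    obtain rfl : k' = 1 - k := by linarith
    simp only [cross]
    linear_combination (w 0 - b 0) * h1 - (w 1 - b 1) * h0
  obtain ⟨d, hd, hed, hed'⟩ := hB e he e' he'
  have hedw := hed w hw
  have hedw' := hed' w hw
  have hdpos : 0 < -(inner ℝ (d - w) (b - w) : ℝ) := by
    have h := hcone d
    have : 0 < k * inner ℝ (e - w) (d - w) + k' * inner ℝ (e' - w) (d - w) := by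
      rcases hk.eq_or_lt with rfl | hk
      · obtain rfl : k' = 1 := by linarith
        linarith
      · have := mul_pos hk hedw
        have := mul_nonneg hk' hedw'.le
        linarith
    rw [← h] at this
    exact (mul_pos_iff_of_pos_left hτ0).1 this
  have hopp : cross b w a * cross b w c < 0 := by
    have h : (inner ℝ (a - b) (w - b) : ℝ) * inner ℝ (c - b) (w - b)
        + cross b w a * cross b w c =
        ((w 0 - b 0) ^ 2 + (w 1 - b 1) ^ 2) * inner ℝ (a - b) (c - b) := by
      simp only [inner_sub_sub_eq, cross]
      ring
    have h1 := mul_pos (haw b hb) (hcw b hb)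
    have h2 := mul_nonpos_of_nonneg_of_nonpos
      (by positivity : 0 ≤ (w 0 - b 0) ^ 2 + (w 1 - b 1) ^ 2) hac
    linarith
  have hpick : ∀ σ : ℝ, ∃ f ∈ B, IsClear R f d ∧ 0 ≤ cross b w f * σ := by
    intro σ
    by_contra! hcon
    have h1 := hcon e he hed
    have h2 := hcon e' he' hed'
    have h : k * (cross b w e * σ) + k' * (cross b w e' * σ) = 0 := by
      linear_combination σ * hcross
    rcases hk.eq_or_lt with rfl | hk
    · obtain rfl : k' = 1 := by linarith
      linarith
    · linarith [mul_neg_of_pos_of_neg hk h1, mul_nonpos_of_nonneg_of_nonpos hk' h2.le]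
  have hbeyond : ∀ {f σ σ'}, IsClear R f d → σ * σ' < 0 → 0 ≤ cross b w d * σ →
      0 ≤ cross b w f * σ' → 0 < -(inner ℝ (f - w) (b - w) : ℝ) := by
    intro f σ σ' hfd hσ hd hf
    have h1 : cross b w f * cross b w d ≤ 0 := by
      by_contra! h
      linarith [mul_neg_of_pos_of_neg h hσ, mul_nonneg hd hf]
    have h2 : -(inner ℝ (d - w) (b - w) : ℝ) * -(inner ℝ (f - w) (b - w) : ℝ)
        + cross b w f * cross b w d =
        ((w 0 - b 0) ^ 2 + (w 1 - b 1) ^ 2) * inner ℝ (f - w) (d - w) := by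
      simp only [inner_sub_sub_eq, cross]
      ring
    have h3 : 0 < (w 0 - b 0) ^ 2 + (w 1 - b 1) ^ 2 := by
      have := real_inner_self_pos.2 hbw
      rw [inner_sub_sub_eq] at this
      linarith
    have := mul_pos h3 (hfd w hw)
    exact (mul_pos_iff_of_pos_left hdpos).1 (by linarith)
  rcases le_total 0 (cross b w d * cross b w a) with hda | hda
  · obtain ⟨f, hf, hfd, hfc⟩ := hpick (cross b w c)
    exact false_of_acute hac (haw b hb) (hcw b hb) hda hfc hdpos
      (hbeyond hfd hopp hda hfc) (hfd.symm w hw) (haw d hd) (hcw f hf)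
      (hdis ha hw hb hd) (hdis hc hw hb hf)
  · have hdc : 0 ≤ cross b w d * cross b w c := by
      by_contra! h
      have hd0 : 0 < cross b w d ^ 2 := by
        refine lt_of_le_of_ne (sq_nonneg _) fun h0 => ?_
        rw [pow_eq_zero_iff two_ne_zero |>.1 h0.symm, zero_mul] at h
        exact lt_irrefl _ h
      linarith [mul_nonneg_of_nonpos_of_nonpos hda h.le, mul_neg_of_pos_of_neg hd0 hopp]
    obtain ⟨f, hf, hfd, hfa⟩ := hpick (cross b w a)
    exact false_of_acute hac (haw b hb) (hcw b hb) hfa hdc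
      (hbeyond hfd (by linarith) hdc hfa) hdpos (hfd w hw) (haw f hf) (hcw d hd)
      (hdis ha hw hb hf) (hdis hc hw hb hd)

theorem hasCommon_range {V : Type*} {G : SimpleGraph V} {f : V → Pt} {P : Set Pt}
    (hP : Disjoint (Set.range f) P)
    (hG : ∀ u v : V, u ≠ v → (G.Adj u v ↔ gabrielDisk (f u) (f v) ∩ P = ∅))
    (hd : ∀ u v : V, u ≠ v → G.Adj u v ∨ ∃ w : V, G.Adj u w ∧ G.Adj v w) :
    HasCommon (Set.range f) P := by
  have hself : ∀ u, IsClear P (f u) (f u) := fun u x hx => by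
    refine real_inner_self_pos.2 (sub_ne_zero.2 ?_)
    rintro rfl
    exact Set.disjoint_left.1 hP ⟨u, rfl⟩ hx
  have hadj : ∀ {u v}, G.Adj u v → IsClear P (f u) (f v) := fun h =>
    isClear_iff.2 ((hG _ _ h.ne).1 h)
  rintro _ ⟨u, rfl⟩ _ ⟨v, rfl⟩
  rcases eq_or_ne u v with rfl | huv
  · exact ⟨_, ⟨u, rfl⟩, hself u, hself u⟩
  rcases hd u v huv with h | ⟨w, huw, hvw⟩
  · exact ⟨_, ⟨v, rfl⟩, hadj h, hself v⟩
  · exact ⟨_, ⟨w, rfl⟩, hadj huw, hadj hvw⟩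

theorem HasCommon.not_subset_convexHull {V : Type*} {G : SimpleGraph V} {f : V → Pt} {P : Set Pt}
    (hPf : P.Finite) (hR : HasCommon (Set.range f) P) (hP : HasCommon P (Set.range f))
    (hG : ∀ u v : V, u ≠ v → (G.Adj u v ↔ gabrielDisk (f u) (f v) ∩ P = ∅))
    (hnc : ∃ u v : V, u ≠ v ∧ ¬ G.Adj u v) {r : Pt} (hr : r ∈ Set.range f) :
    r ∉ convexHull ℝ P := by
  intro h
  obtain ⟨u, v, huv, hn⟩ := hnc
  exact hn ((hG u v huv).2 (isClear_iff.1 (hR.isClear_of_subset hPf hP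
    (fun r' hr' => hR.mem_convexHull hPf hP hr hr' h) ⟨u, rfl⟩ ⟨v, rfl⟩)))

/-- Theorem 1: an MWG-drawing of two graphs of diameter exactly 2 is linearly separable. -/
theorem stmt4 {V₀ V₁ : Type*} [Fintype V₀] [Fintype V₁]
    (G₀ : SimpleGraph V₀) (G₁ : SimpleGraph V₁) (f₀ : V₀ → Pt) (f₁ : V₁ → Pt)
    (hMWG : IsMWGDrawing G₀ G₁ f₀ f₁)
    (hd₀ : ∀ u v : V₀, u ≠ v → G₀.Adj u v ∨ ∃ w : V₀, G₀.Adj u w ∧ G₀.Adj v w)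
    (hd₁ : ∀ u v : V₁, u ≠ v → G₁.Adj u v ∨ ∃ w : V₁, G₁.Adj u w ∧ G₁.Adj v w)
    (hnc₀ : ∃ u v : V₀, u ≠ v ∧ ¬ G₀.Adj u v)
    (hnc₁ : ∃ u v : V₁, u ≠ v ∧ ¬ G₁.Adj u v) :
    LinSep (Set.range f₀) (Set.range f₁) := by
  obtain ⟨-, -, hdisj, hG₀, hG₁⟩ := hMWG
  have hR := hasCommon_range hdisj hG₀ hd₀
  have hB := hasCommon_range hdisj.symm hG₁ hd₁
  have hRf := Set.finite_range f₀
  have hBf := Set.finite_range f₁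
  have hhull : Disjoint (convexHull ℝ (Set.range f₀)) (convexHull ℝ (Set.range f₁)) := by
    by_contra h
    rcases hR.exists_mem_convexHull hRf hBf hB h with ⟨r, hr, hrB⟩ | ⟨b, hb, hbR⟩
    · exact hR.not_subset_convexHull hBf hB hG₀ hnc₀ hr hrB
    · exact hB.not_subset_convexHull hRf hR hG₁ hnc₁ hb hbR
  obtain ⟨φ, c, c', hc, hcc', hc'⟩ := geometric_hahn_banach_compact_closed
    (convex_convexHull ℝ _) (hRf.isCompact_convexHull ℝ) (convex_convexHull ℝ _)
    (hBf.isClosed_convexHull ℝ) hhull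
  refine ⟨φ, c, ?_, fun a ha => hc a (subset_convexHull ℝ _ ha),
    fun b hb => hcc'.trans (hc' b (subset_convexHull ℝ _ hb))⟩
  intro h0
  have hφ : ∀ p, φ p = 0 := fun p => LinearMap.congr_fun h0 p
  obtain ⟨u, -⟩ := hnc₀
  obtain ⟨v, -⟩ := hnc₁
  have h1 := hc _ (subset_convexHull ℝ _ (Set.mem_range_self u))
  have h2 := hc' _ (subset_convexHull ℝ _ (Set.mem_range_self v))
  rw [hφ] at h1 h2
  linarith
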